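/- Let R be a Noetherian ring, I an ideal of R, and M, N two finitely generated R-modules. If Supp M ⊆ Supp N, then q(I, M) ≤ q(I, N). -/

import Mathlib

universe u

open CategoryTheory

/-- `q(I, M)`: the supremum (in `WithBot ℕ∞`, so that the supremum of the empty set is
`⊥ = -∞`) of the set of indices `i` such that `H^i_I(M)` is not Artinian. -/
noncomputable def qDim {R : Type u} [CommRing R] (I : Ideal R) (M : ModuleCat.{u} R) :
    WithBot ℕ∞ :=
  sSup ((fun i : ℕ => ((i : ℕ∞) : WithBot ℕ∞)) ''
    {i : ℕ | ¬ IsArtinian R ((localCohomology I i).obj M)})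

namespace QD
variable {R : Type u} [CommRing R]

/-- The map induced on `Hom`-complexes. -/
noncomputable def yonMap {P P' : ChainComplex (ModuleCat.{u} R) ℕ} (φ : P ⟶ P') (Y : ModuleCat.{u} R) :
    P'.linearYonedaObj R Y ⟶ P.linearYonedaObj R Y :=
  (HomologicalComplex.unopFunctor _ _).map
    ((((linearYoneda R (ModuleCat.{u} R)).obj Y).rightOp.mapHomologicalComplex _).map φ).op

lemma yonMap_f {P P' : ChainComplex (ModuleCat.{u} R) ℕ} (φ : P ⟶ P') (Y : ModuleCat.{u} R)
    (n : ℕ) (g : P'.X n ⟶ Y) :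
    ((yonMap φ Y).f n).hom g = φ.f n ≫ g := rfl

lemma yon_d (P : ChainComplex (ModuleCat.{u} R) ℕ) (Y : ModuleCat.{u} R)
    (n m : ℕ) (g : P.X n ⟶ Y) :
    ((P.linearYonedaObj R Y).d n m).hom g = P.d m n ≫ g := rfl

lemma glue {C : Type*} [Category* C] {A A' B B' D D' : C} (m : A' ⟶ A) (p : A ⟶ B) (p' : A' ⟶ B')
    (k : B' ⟶ B) (h : D' ⟶ B') (hi : B' ⟶ D') (g : D ⟶ B) (gi : B ⟶ D) (r : D' ⟶ D)
    (e1 : m ≫ p = p' ≫ k) (e2 : h ≫ k = r ≫ g) (_ : h ≫ hi = 𝟙 _) (e4 : hi ≫ h = 𝟙 _)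
    (e5 : g ≫ gi = 𝟙 _) : m ≫ (p ≫ gi) = (p' ≫ hi) ≫ r := by
  have : k = hi ≫ r ≫ g := by rw [← e2, ← Category.assoc, e4, Category.id_comp]
  rw [← Category.assoc, e1, this]
  simp [e5]

lemma isoExt_nat {X X' : ModuleCat.{u} R} (f : X ⟶ X') (P : ProjectiveResolution X)
    (P' : ProjectiveResolution X') (φ : P.complex ⟶ P'.complex)
    (comm : φ.f 0 ≫ P'.π.f 0 = P.π.f 0 ≫ f) (n : ℕ) (Y : ModuleCat.{u} R) :
    ((Ext R (ModuleCat.{u} R) n).map f.op).app Y ≫ (P.isoExt n Y).hom =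
      (P'.isoExt n Y).hom ≫ HomologicalComplex.homologyMap (yonMap φ Y) n := by
  have h1 := ProjectiveResolution.isoLeftDerivedObj_inv_naturality f P P' φ comm
    ((linearYoneda R (ModuleCat.{u} R)).obj Y).rightOp n
  have h2 := HomologicalComplex.homologyOp_hom_naturality (yonMap φ Y) n
  have h1' := congrArg Quiver.Hom.unop h1
  have h2' := congrArg Quiver.Hom.unop h2
  simp only [unop_comp] at h1' h2'
  change _ ≫ ((P.isoLeftDerivedObj ((linearYoneda R _).obj Y).rightOp n).inv.unop ≫
    ((P.complex.linearYonedaObj R Y).homologyOp n).inv.unop) =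
    ((P'.isoLeftDerivedObj ((linearYoneda R _).obj Y).rightOp n).inv.unop ≫
    ((P'.complex.linearYonedaObj R Y).homologyOp n).inv.unop) ≫ _
  exact glue _ _ _ _ _ _ _ _ _ h1' h2'
    (congrArg Quiver.Hom.unop ((P'.complex.linearYonedaObj R Y).homologyOp n).inv_hom_id)
    (congrArg Quiver.Hom.unop ((P'.complex.linearYonedaObj R Y).homologyOp n).hom_inv_id)
    (congrArg Quiver.Hom.unop ((P.complex.linearYonedaObj R Y).homologyOp n).inv_hom_id)


/-- Cocycles. -/
noncomputable def Zc (P : ChainComplex (ModuleCat.{u} R) ℕ) (Y : ModuleCat.{u} R) (n : ℕ) :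
    Submodule R (P.X n ⟶ Y) where
  carrier := {f | P.d (n+1) n ≫ f = 0}
  add_mem' := by
    intro a b ha hb
    simp only [Set.mem_ofPred_eq] at *
    simp [ha, hb]
  zero_mem' := by simp
  smul_mem' := by
    intro c a ha
    simp only [Set.mem_ofPred_eq] at *
    simp [ha]

lemma mem_Zc {P : ChainComplex (ModuleCat.{u} R) ℕ} {Y : ModuleCat.{u} R} {n : ℕ} {f : P.X n ⟶ Y} :
  f ∈ Zc P Y n ↔ P.d (n+1) n ≫ f = 0 := Iff.rfl

/-- Lift to the cycles. -/
noncomputable def toCyc (P : ChainComplex (ModuleCat.{u} R) ℕ) (Y : ModuleCat.{u} R) (n : ℕ) :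
    ModuleCat.of R (Zc P Y n) ⟶ (P.linearYonedaObj R Y).cycles n :=
  (P.linearYonedaObj R Y).liftCycles (A := ModuleCat.of R (Zc P Y n))
    (ModuleCat.ofHom (Zc P Y n).subtype) (n+1) (by simp) (by
      ext1
      refine LinearMap.ext fun f => ?_
      exact f.2)

lemma toCyc_i (P : ChainComplex (ModuleCat.{u} R) ℕ) (Y : ModuleCat.{u} R) (n : ℕ) (f : Zc P Y n) :
    ((P.linearYonedaObj R Y).iCycles n).hom ((toCyc P Y n).hom f) = f.1 := by
  have : toCyc P Y n ≫ (P.linearYonedaObj R Y).iCycles n = ModuleCat.ofHom (Zc P Y n).subtype :=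
    (P.linearYonedaObj R Y).liftCycles_i _ _ _ _
  exact congrArg (fun g => g.hom f) this

lemma iCyc_inj (K : CochainComplex (ModuleCat.{u} R) ℕ) (n : ℕ) :
    Function.Injective (K.iCycles n).hom :=
  (ModuleCat.mono_iff_injective _).1 inferInstance

lemma toCyc_surj (P : ChainComplex (ModuleCat.{u} R) ℕ) (Y : ModuleCat.{u} R) (n : ℕ) :
    Function.Surjective (toCyc P Y n).hom := by
  intro c
  have h : (P.linearYonedaObj R Y).iCycles n ≫ (P.linearYonedaObj R Y).d n (n+1) = 0 :=
    (P.linearYonedaObj R Y).iCycles_d n (n+1)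
  refine ⟨⟨((P.linearYonedaObj R Y).iCycles n).hom c, ?_⟩, ?_⟩
  · exact congrArg (fun g => g.hom c) h
  · apply iCyc_inj
    rw [toCyc_i]

/-- Class in homology. -/
noncomputable def oldCls (P : ChainComplex (ModuleCat.{u} R) ℕ) (Y : ModuleCat.{u} R) (n : ℕ) :
    Zc P Y n →ₗ[R] (P.linearYonedaObj R Y).homology n :=
  (toCyc P Y n ≫ (P.linearYonedaObj R Y).homologyπ n).hom

lemma oldCls_surj (P : ChainComplex (ModuleCat.{u} R) ℕ) (Y : ModuleCat.{u} R) (n : ℕ) :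
    Function.Surjective (oldCls P Y n) := by
  have h : Function.Surjective ((P.linearYonedaObj R Y).homologyπ n).hom :=
    (ModuleCat.epi_iff_surjective _).1 inferInstance
  exact h.comp (toCyc_surj P Y n)

lemma oldCls_ker (P : ChainComplex (ModuleCat.{u} R) ℕ) (Y : ModuleCat.{u} R) (n : ℕ)
    (f : Zc P Y n) : oldCls P Y n f = 0 ↔ ∃ p, ∃ g : P.X p ⟶ Y, P.d n p ≫ g = f.1 := by
  let K := P.linearYonedaObj R Y
  constructor
  · intro h
    have ex := ShortComplex.exact_of_g_is_cokernel
      (ShortComplex.mk (K.toCycles ((ComplexShape.up ℕ).prev n) n) (K.homologyπ n) (by simp))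
      (K.homologyIsCokernel _ n rfl)
    rw [ShortComplex.moduleCat_exact_iff] at ex
    obtain ⟨g, hg⟩ := ex ((toCyc P Y n).hom f) h
    refine ⟨_, g, ?_⟩
    have h1 : K.toCycles ((ComplexShape.up ℕ).prev n) n ≫ K.iCycles n = K.d _ n := by simp
    have h2 := congrArg (fun u => u.hom g) h1
    refine h2.symm.trans ?_
    refine (congrArg (K.iCycles n).hom hg).trans ?_
    exact toCyc_i _ _ _ _
  · rintro ⟨p, g, hg⟩
    have h1 : (K.toCycles p n).hom g = (toCyc P Y n).hom f := by
      apply iCyc_inj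
      rw [toCyc_i, ← hg]
      have h1 : K.toCycles p n ≫ K.iCycles n = K.d p n := by simp
      exact congrArg (fun u => u.hom g) h1
    change (K.homologyπ n).hom ((toCyc P Y n).hom f) = 0
    rw [← h1]
    have h2 : K.toCycles p n ≫ K.homologyπ n = 0 := by simp
    exact congrArg (fun u => u.hom g) h2

/-- Pulling back cocycles. -/
noncomputable def Zmap {P P' : ChainComplex (ModuleCat.{u} R) ℕ} (φ : P ⟶ P') (Y : ModuleCat.{u} R)
    (n : ℕ) (f : Zc P' Y n) : Zc P Y n :=
  ⟨φ.f n ≫ f.1, by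
    have := f.2
    rw [mem_Zc] at this ⊢
    rw [← φ.comm_assoc, this, Limits.comp_zero]⟩

lemma oldCls_nat {P P' : ChainComplex (ModuleCat.{u} R) ℕ} (φ : P ⟶ P') (Y : ModuleCat.{u} R)
    (n : ℕ) (f : Zc P' Y n) :
    (HomologicalComplex.homologyMap (yonMap φ Y) n).hom (oldCls P' Y n f) =
      oldCls P Y n (Zmap φ Y n f) := by
  have h1 := HomologicalComplex.homologyπ_naturality (yonMap φ Y) n
  have h2 := congrArg (fun u => u.hom ((toCyc P' Y n).hom f)) h1
  refine h2.trans ?_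
  refine congrArg ((P.linearYonedaObj R Y).homologyπ n).hom (?_ :
    (HomologicalComplex.cyclesMap (yonMap φ Y) n).hom ((toCyc P' Y n).hom f) = (toCyc P Y n).hom _)
  apply iCyc_inj
  rw [toCyc_i]
  have h3 := HomologicalComplex.cyclesMap_i (yonMap φ Y) n
  refine (congrArg (fun u => u.hom ((toCyc P' Y n).hom f)) h3).trans ?_
  change ((yonMap φ Y).f n).hom (((P'.linearYonedaObj R Y).iCycles n).hom ((toCyc P' Y n).hom f)) = _
  rw [toCyc_i]
  rfl

/-- Class in Ext. -/
noncomputable def newCls {X : ModuleCat.{u} R} (P : ProjectiveResolution X) (Y : ModuleCat.{u} R) (n : ℕ) :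
    Zc P.complex Y n →ₗ[R] Abelian.Ext X Y n where
  toFun f := P.extMk f.1 (n+1) rfl (mem_Zc.1 f.2)
  map_add' f g := (P.add_extMk _ _ _ _ _ _).symm
  map_smul' r f := by
    rw [Abelian.Ext.smul_eq_comp_mk₀]
    simp only [RingHom.id_apply]
    rw [P.extMk_comp_mk₀]
    congr 1

lemma newCls_surj {X : ModuleCat.{u} R} (P : ProjectiveResolution X) (Y : ModuleCat.{u} R) (n : ℕ) :
    Function.Surjective (newCls P Y n) := by
  intro a
  obtain ⟨f, hf, h⟩ := P.extMk_surjective a (n+1) rfl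
  exact ⟨⟨f, hf⟩, h⟩

lemma newCls_ker {X : ModuleCat.{u} R} (P : ProjectiveResolution X) (Y : ModuleCat.{u} R) (n : ℕ)
    (f : Zc P.complex Y n) :
    newCls P Y n f = 0 ↔ ∃ p, ∃ g : P.complex.X p ⟶ Y, P.complex.d n p ≫ g = f.1 := by
  cases n with
  | succ n =>
    refine (P.extMk_eq_zero_iff f.1 (n+1+1) rfl (mem_Zc.1 f.2) n rfl).trans ⟨fun ⟨g, h⟩ => ⟨n, g, h⟩, ?_⟩
    rintro ⟨p, g, h⟩
    by_cases hp : p = n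
    · subst hp; exact ⟨g, h⟩
    · refine ⟨0, ?_⟩
      rw [← h, P.complex.shape (n+1) p (by simp; omega)]
      simp
  | zero =>
    constructor
    · intro h
      refine ⟨0, 0, ?_⟩
      change P.extMk f.1 (0+1) rfl (mem_Zc.1 f.2) = 0 at h
      simp only [← P.extEquivCohomologyClass.apply_eq_iff_eq,
        ProjectiveResolution.extEquivCohomologyClass_extMk,
        ProjectiveResolution.extEquivCohomologyClass_zero,
        CochainComplex.HomComplex.CohomologyClass.mk_eq_zero_iff] at h
      rw [CochainComplex.HomComplex.Cocycle.toSingleMk_mem_coboundaries_iff _ _ _ _ _ (1) (by simp)] at h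
      obtain ⟨g, hg⟩ := h
      have hz : Limits.IsZero (P.cochainComplex.X 1) :=
        CochainComplex.isZero_of_isStrictlyLE _ 0 1 (by norm_num)
      rw [hz.eq_of_src g 0, Limits.comp_zero] at hg
      rw [← cancel_epi (P.cochainComplexXIso (-(0:ℕ)) 0 rfl).hom, ← hg]
      simp
    · rintro ⟨p, g, h⟩
      have : f = 0 := by
        ext1
        rw [← h, P.complex.shape 0 p (by simp)]
        simp
      rw [this, map_zero]

lemma newCls_nat {X X' : ModuleCat.{u} R} (f : X ⟶ X') (P : ProjectiveResolution X)
    (P' : ProjectiveResolution X') (φ : ProjectiveResolution.Hom P P' f) (n : ℕ) (Y : ModuleCat.{u} R)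
    (z : Zc P'.complex Y n) :
    (Abelian.Ext.mk₀ f).comp (newCls P' Y n z) (zero_add n) = newCls P Y n (Zmap φ.hom Y n z) :=
  ProjectiveResolution.mk₀_comp_extMk _ _ rfl (mem_Zc.1 z.2) φ

lemma exists_equiv {Z A B : Type*} [AddCommGroup Z] [Module R Z] [AddCommGroup A] [Module R A]
    [AddCommGroup B] [Module R B] (f : Z →ₗ[R] A) (g : Z →ₗ[R] B) (hf : Function.Surjective f)
    (hg : Function.Surjective g) (h : ∀ z, f z = 0 ↔ g z = 0) :
    ∃ e : A ≃ₗ[R] B, ∀ z, e (f z) = g z := by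
  have hk : LinearMap.ker f = LinearMap.ker g := by ext z; simpa using h z
  refine ⟨(f.quotKerEquivOfSurjective hf).symm ≪≫ₗ Submodule.quotEquivOfEq _ _ hk ≪≫ₗ
    g.quotKerEquivOfSurjective hg, fun z => ?_⟩
  have : (f.quotKerEquivOfSurjective hf).symm (f z) = Submodule.Quotient.mk z := by
    rw [LinearEquiv.symm_apply_eq]; rfl
  simp only [LinearEquiv.trans_apply, this]
  rfl

lemma exists_extEquiv (X Y : ModuleCat.{u} R) (n : ℕ) :
    ∃ e : ((Ext R (ModuleCat.{u} R) n).obj (Opposite.op X)).obj Y ≃ₗ[R] Abelian.Ext X Y n,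
      ∀ z, e (((projectiveResolution X).isoExt n Y).inv.hom (oldCls _ Y n z)) =
        newCls (projectiveResolution X) Y n z := by
  have hi : Function.Bijective ((projectiveResolution X).isoExt (R := R) n Y).inv.hom :=
    ConcreteCategory.bijective_of_isIso ((projectiveResolution X).isoExt (R := R) n Y).inv
  refine exists_equiv (((projectiveResolution X).isoExt n Y).inv.hom ∘ₗ (oldCls _ Y n)) _
    (hi.2.comp (oldCls_surj _ _ _)) (newCls_surj _ _ _) fun z => ?_
  rw [newCls_ker, ← oldCls_ker]
  simp only [LinearMap.comp_apply]
  exact map_eq_zero_iff _ hi.1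

noncomputable def extEquiv (X Y : ModuleCat.{u} R) (n : ℕ) :
    ((Ext R (ModuleCat.{u} R) n).obj (Opposite.op X)).obj Y ≃ₗ[R] Abelian.Ext X Y n :=
  (exists_extEquiv X Y n).choose

lemma extEquiv_nat {X X' : ModuleCat.{u} R} (f : X ⟶ X') (Y : ModuleCat.{u} R) (n : ℕ)
    (a : ((Ext R (ModuleCat.{u} R) n).obj (Opposite.op X')).obj Y) :
    extEquiv X Y n ((((Ext R (ModuleCat.{u} R) n).map f.op).app Y).hom a) =
      (Abelian.Ext.mk₀ f).comp (extEquiv X' Y n a) (zero_add n) := by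
  have hi : Function.Bijective ((projectiveResolution X').isoExt (R := R) n Y).inv.hom :=
    ConcreteCategory.bijective_of_isIso ((projectiveResolution X').isoExt (R := R) n Y).inv
  obtain ⟨z, rfl⟩ := (hi.2.comp (oldCls_surj _ _ _)) a
  let φ : ProjectiveResolution.Hom (projectiveResolution X) (projectiveResolution X') f :=
    ⟨ProjectiveResolution.lift f _ _,
      (ProjectiveResolution.lift_commutes_zero _ _ _).trans (by simp)⟩
  have hc : φ.hom.f 0 ≫ (projectiveResolution X').π.f 0 = (projectiveResolution X).π.f 0 ≫ f :=
    ProjectiveResolution.lift_commutes_zero _ _ _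
  have h1 := isoExt_nat f _ _ φ.hom hc n Y
  rw [← Iso.inv_comp_eq, ← Category.assoc, ← Iso.eq_comp_inv] at h1
  have h2 := congrArg (fun u => u.hom (oldCls _ Y n z)) h1
  have h3 := oldCls_nat φ.hom Y n z
  have h4 : (((Ext R (ModuleCat.{u} R) n).map f.op).app Y).hom
      (((projectiveResolution X').isoExt n Y).inv.hom (oldCls _ Y n z)) =
      ((projectiveResolution X).isoExt n Y).inv.hom (oldCls _ Y n (Zmap φ.hom Y n z)) := by
    rw [← h3]; exact h2
  have h5 := (exists_extEquiv X Y n).choose_spec (Zmap φ.hom Y n z)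
  have h6 := (exists_extEquiv X' Y n).choose_spec z
  refine (congrArg (extEquiv X Y n) h4).trans (h5.trans ?_)
  rw [← newCls_nat]
  exact congrArg (fun t => (Abelian.Ext.mk₀ f).comp t (zero_add n)) h6.symm


/-- `R ⧸ I ^ t` -/
noncomputable abbrev Qm (I : Ideal R) (t : ℕ) : ModuleCat.{u} R := ModuleCat.of R (R ⧸ I ^ t)

/-- transition map -/
noncomputable def qm (I : Ideal R) {s t : ℕ} (h : s ≤ t) : Qm I t ⟶ Qm I s :=
  ModuleCat.ofHom <| Submodule.mapQ _ _ LinearMap.id (Ideal.pow_le_pow_right h)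

lemma qm_apply (I : Ideal R) {s t : ℕ} (h : s ≤ t) (r : R) :
    (qm I h).hom (Ideal.Quotient.mk _ r) = Ideal.Quotient.mk _ r := rfl

lemma Qm_ext {I : Ideal R} {t : ℕ} {M : ModuleCat.{u} R} {f g : Qm I t ⟶ M}
    (h : f.hom (Ideal.Quotient.mk _ 1) = g.hom (Ideal.Quotient.mk _ 1)) : f = g := by
  ext1
  apply Submodule.linearMap_qext
  ext
  exact h

/-- transition map on Ext -/
noncomputable abbrev tr (I : Ideal R) (i : ℕ) (M : ModuleCat.{u} R) (s t : ℕ) (h : s ≤ t) :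
    Abelian.Ext (Qm I s) M i →ₗ[R] Abelian.Ext (Qm I t) M i :=
  (Abelian.Ext.mk₀ (qm I h)).precompOfLinear R M (zero_add i)

instance trDirected (I : Ideal R) (i : ℕ) (M : ModuleCat.{u} R) :
    DirectedSystem (fun t => Abelian.Ext (Qm I t) M i) (fun s t h => tr I i M s t h) where
  map_self t x := by
    have : qm I (le_refl t) = 𝟙 _ := Qm_ext rfl
    simp [this]
  map_map s t w hst htw x := by
    have : qm I htw ≫ qm I hst = qm I (hst.trans htw) := Qm_ext rfl
    simp [← this]

/-- model for local cohomology. -/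
noncomputable abbrev T (I : Ideal R) (i : ℕ) (M : ModuleCat.{u} R) : Type u :=
  Module.DirectLimit (fun t => Abelian.Ext (Qm I t) M i) (fun s t h => tr I i M s t h)

noncomputable abbrev ofT (I : Ideal R) (i : ℕ) (M : ModuleCat.{u} R) (t : ℕ) :
    Abelian.Ext (Qm I t) M i →ₗ[R] T I i M :=
  Module.DirectLimit.of R ℕ (fun t => Abelian.Ext (Qm I t) M i) (fun s t h => tr I i M s t h) t

lemma ofT_surj {I : Ideal R} {i : ℕ} {M : ModuleCat.{u} R} (x : T I i M) :
    ∃ t y, ofT I i M t y = x := Module.DirectLimit.exists_of x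

lemma ofT_tr {I : Ideal R} {i : ℕ} {M : ModuleCat.{u} R} {s t : ℕ} (h : s ≤ t) (x) :
    ofT I i M t (tr I i M s t h x) = ofT I i M s x := Module.DirectLimit.of_f

lemma ofT_zero {I : Ideal R} {i : ℕ} {M : ModuleCat.{u} R} {s : ℕ} {x} (h : ofT I i M s x = 0) :
    ∃ t, ∃ h : s ≤ t, tr I i M s t h x = 0 :=
  Module.DirectLimit.of.zero_exact h

open Limits localCohomology Opposite in
lemma exists_lc_equiv (I : Ideal R) (i : ℕ) (M : ModuleCat.{u} R) :
    Nonempty (T I i M ≃ₗ[R] ((localCohomology I i).obj M)) := by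
  let D := diagram (idealPowersDiagram I) i
  let c : Cocone (D ⋙ (evaluation _ _).obj M) := ((evaluation _ _).obj M).mapCocone (colimit.cocone D)
  have hc : IsColimit c := isColimitOfPreserves _ (colimit.isColimit D)
  have e1 : ∀ t : ℕ, (D ⋙ (evaluation _ _).obj M).obj (op (op t)) =
    ((Ext R (ModuleCat.{u} R) i).obj (op (Qm I t))).obj M := fun t => rfl
  let g : ∀ t : ℕ, Abelian.Ext (Qm I t) M i →ₗ[R] c.pt := fun t =>
    (c.ι.app (op (op t))).hom ∘ₗ (extEquiv (Qm I t) M i).symm.toLinearMap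
  have hmap : ∀ (s t : ℕ) (h : s ≤ t),
      (D ⋙ (evaluation _ _).obj M).map (homOfLE h).op.op =
      ((Ext R (ModuleCat.{u} R) i).map (qm I h).op).app M := fun s t h => rfl
  have key : ∀ (s t : ℕ) (h : s ≤ t) (x : Abelian.Ext (Qm I s) M i),
      (extEquiv (Qm I t) M i).symm (tr I i M s t h x) =
      ((D ⋙ (evaluation _ _).obj M).map (homOfLE h).op.op).hom
        ((extEquiv (Qm I s) M i).symm x) := by
    intro s t h x
    refine (LinearEquiv.symm_apply_eq _).2 ?_
    refine Eq.trans ?_ (extEquiv_nat (qm I h) M i ((extEquiv (Qm I s) M i).symm x)).symm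
    exact congrArg (fun z => (Abelian.Ext.mk₀ (qm I h)).comp z (zero_add i))
      (LinearEquiv.apply_symm_apply (extEquiv (Qm I s) M i) x).symm
  have hg : ∀ s t h x, g t (tr I i M s t h x) = g s x := by
    intro s t h x
    refine (congrArg (c.ι.app (op (op t))).hom (key s t h x)).trans ?_
    exact congrArg (fun u => u.hom ((extEquiv (Qm I s) M i).symm x)) (c.w (homOfLE h).op.op)
  let L : T I i M →ₗ[R] c.pt := Module.DirectLimit.lift R ℕ _ _ g hg
  have hL : ∀ t x, L (ofT I i M t x) = g t x := fun t x => Module.DirectLimit.lift_of _ _ _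
  have hpf : PreservesColimit (D ⋙ (evaluation _ _).obj M) (forget (ModuleCat.{u} R)) := by
    have := preservesFilteredColimitsOfSize_shrink.{0, u, 0, u} (forget (ModuleCat.{u} R))
    infer_instance
  refine ⟨LinearEquiv.ofBijective L ⟨?_, ?_⟩⟩
  · rw [injective_iff_map_eq_zero]
    intro x hx
    obtain ⟨t, y, rfl⟩ := ofT_surj x
    rw [hL] at hx
    have h0 : (c.ι.app (op (op t))).hom ((extEquiv (Qm I t) M i).symm y) =
      (c.ι.app (op (op t))).hom 0 := by rw [map_zero]; exact hx
    obtain ⟨k, f, f', hk⟩ := Concrete.isColimit_exists_of_rep_eq _ hc _ _ h0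
    obtain ⟨⟨k⟩⟩ := k
    have hle : t ≤ k := leOfHom f.unop.unop
    have hf : f = (homOfLE hle).op.op := Subsingleton.elim _ _
    subst hf
    rw [← ofT_tr hle]
    have h2 := key t k hle y
    have h3 : (extEquiv (Qm I k) M i).symm (tr I i M t k hle y) = 0 :=
      h2.trans (hk.trans (map_zero _))
    rw [LinearEquiv.map_eq_zero_iff] at h3
    rw [h3, map_zero]
  · intro z
    obtain ⟨⟨⟨t⟩⟩, y, rfl⟩ := Concrete.isColimit_exists_rep _ hc z
    refine ⟨ofT I i M t (extEquiv (Qm I t) M i y), ?_⟩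
    rw [hL]
    exact congrArg (c.ι.app (op (op t))).hom (LinearEquiv.symm_apply_apply _ y)

/-- The map induced by an Ext class. -/
noncomputable def mapT (I : Ideal R) {M M' : ModuleCat.{u} R} {a : ℕ} (α : Abelian.Ext M M' a)
    {i j : ℕ} (h : i + a = j) : T I i M →ₗ[R] T I j M' :=
  Module.DirectLimit.map (fun t => α.postcompOfLinear R (Qm I t) h) (by
    intro s t hst
    refine LinearMap.ext fun x => ?_
    exact Abelian.Ext.comp_assoc (Abelian.Ext.mk₀ (qm I hst)) x α (zero_add i) h (by omega))

lemma mapT_of (I : Ideal R) {M M' : ModuleCat.{u} R} {a : ℕ} (α : Abelian.Ext M M' a)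
    {i j : ℕ} (h : i + a = j) (t : ℕ) (x : Abelian.Ext (Qm I t) M i) :
    mapT I α h (ofT I i M t x) = ofT I j M' t (x.comp α h) :=
  Module.DirectLimit.map_apply_of _ _ _

lemma mapT_exact (I : Ideal R) {M M' M₃ : ModuleCat.{u} R} {a b : ℕ} (α : Abelian.Ext M M' a)
    (β : Abelian.Ext M' M₃ b) {i j k : ℕ} (h : i + a = j) (h' : j + b = k)
    (hz : α.comp β rfl = 0)
    (hex : ∀ t, ∀ x : Abelian.Ext (Qm I t) M' j, x.comp β h' = 0 → ∃ y : Abelian.Ext (Qm I t) M i, y.comp α h = x) :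
    Function.Exact (mapT I α h) (mapT I β h') := by
  intro x
  constructor
  · intro hx
    obtain ⟨t, y, rfl⟩ := ofT_surj x
    rw [mapT_of] at hx
    obtain ⟨s, hs, hx⟩ := ofT_zero hx
    have h2 : (tr I j M' t s hs y).comp β h' = 0 := by
      rw [← hx]
      exact Abelian.Ext.comp_assoc (Abelian.Ext.mk₀ (qm I hs)) y β (zero_add j) h' (by omega)
    obtain ⟨w, hw⟩ := hex s _ h2
    refine ⟨ofT I i M s w, ?_⟩
    rw [mapT_of, hw, ofT_tr]
  · rintro ⟨y, rfl⟩
    obtain ⟨t, y, rfl⟩ := ofT_surj y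
    rw [mapT_of, mapT_of, Abelian.Ext.comp_assoc y α β h rfl (by omega), hz, Abelian.Ext.comp_zero, map_zero]

section les
variable (I : Ideal R) {S : ShortComplex (ModuleCat.{u} R)} (hS : S.ShortExact) (i : ℕ)
open Abelian

lemma exact₂ {I : Ideal R} {S : ShortComplex (ModuleCat.{u} R)} (hS : S.ShortExact) (i : ℕ) : Function.Exact (mapT I (Ext.mk₀ S.f) (add_zero i)) (mapT I (Ext.mk₀ S.g) (add_zero i)) :=
  mapT_exact I _ _ _ _ (by simp) fun _ x hx => Ext.covariant_sequence_exact₂ _ hS x hx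

lemma exact₃ : Function.Exact (mapT I (Ext.mk₀ S.g) (add_zero i)) (mapT I hS.extClass (rfl : i + 1 = i + 1)) :=
  mapT_exact I _ _ _ _ (by simp) fun _ x hx => Ext.covariant_sequence_exact₃ _ hS x _ hx

lemma exact₁ : Function.Exact (mapT I hS.extClass (rfl : i + 1 = i + 1)) (mapT I (Ext.mk₀ S.f) (add_zero (i+1))) :=
  mapT_exact I _ _ _ _ (by simp) fun _ x hx => Ext.covariant_sequence_exact₁ _ hS x hx _
end les


section ses
variable {A B C : Type u} [AddCommGroup A] [AddCommGroup B] [AddCommGroup C]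
  [Module R A] [Module R B] [Module R C] {f : A →ₗ[R] B} {g : B →ₗ[R] C}

/-- the short complex attached to an exact pair. -/
noncomputable abbrev sc (f : A →ₗ[R] B) (g : B →ₗ[R] C) (he : Function.Exact f g) :
    ShortComplex (ModuleCat.{u} R) :=
  ShortComplex.mk (ModuleCat.ofHom f) (ModuleCat.ofHom g) (by
    ext x
    exact he.apply_apply_eq_zero x)

lemma sc_exact (hf : Function.Injective f) (hg : Function.Surjective g)
    (he : Function.Exact f g) : (sc f g he).ShortExact where
  exact := (ShortComplex.ShortExact.moduleCat_exact_iff_function_exact _).2 he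
  mono_f := (ModuleCat.mono_iff_injective _).2 hf
  epi_g := (ModuleCat.epi_iff_surjective _).2 hg

/-- vanishing -/
def V (I : Ideal R) (i : ℕ) (M : Type u) [AddCommGroup M] [Module R M] : Prop :=
  Subsingleton (T I i (ModuleCat.of R M))

/-- Artinianness -/
def Ar (I : Ideal R) (i : ℕ) (M : Type u) [AddCommGroup M] [Module R M] : Prop :=
  IsArtinian R (T I i (ModuleCat.of R M))

lemma subs_mid {X Y Z : Type*} [AddCommGroup X] [AddCommGroup Y] [AddCommGroup Z]
    [Module R X] [Module R Y] [Module R Z] {f : X →ₗ[R] Y} {g : Y →ₗ[R] Z}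
    (h : Function.Exact f g) (hX : Subsingleton X) (hZ : Subsingleton Z) : Subsingleton Y := by
  refine subsingleton_of_forall_eq 0 fun y => ?_
  obtain ⟨x, rfl⟩ := (h y).1 (Subsingleton.elim _ _)
  rw [Subsingleton.elim x 0, map_zero]

lemma art_mid {X Y Z : Type*} [AddCommGroup X] [AddCommGroup Y] [AddCommGroup Z]
    [Module R X] [Module R Y] [Module R Z] {f : X →ₗ[R] Y} {g : Y →ₗ[R] Z}
    (h : Function.Exact f g) (hX : IsArtinian R X) (hZ : IsArtinian R Z) : IsArtinian R Y :=
  isArtinian_of_range_eq_ker f g h.linearMap_ker_eq.symm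

lemma V₂ {I : Ideal R} {i : ℕ} (hf : Function.Injective f) (hg : Function.Surjective g)
    (he : Function.Exact f g) (hA : V I i A) (hC : V I i C) : V I i B :=
  subs_mid (exact₂ (I := I) (sc_exact hf hg he) i) hA hC

lemma V₃ {I : Ideal R} {i : ℕ} (hf : Function.Injective f) (hg : Function.Surjective g)
    (he : Function.Exact f g) (hB : V I i B) (hA : V I (i+1) A) : V I i C :=
  subs_mid (exact₃ I (sc_exact hf hg he) i) hB hA

lemma V₁ {I : Ideal R} {i : ℕ} (hf : Function.Injective f) (hg : Function.Surjective g)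
    (he : Function.Exact f g) (hC : V I i C) (hB : V I (i+1) B) : V I (i+1) A :=
  subs_mid (exact₁ I (sc_exact hf hg he) i) hC hB

lemma Ar₂ {I : Ideal R} {i : ℕ} (hf : Function.Injective f) (hg : Function.Surjective g)
    (he : Function.Exact f g) (hA : Ar I i A) (hC : Ar I i C) : Ar I i B :=
  art_mid (exact₂ (I := I) (sc_exact hf hg he) i) hA hC

lemma Ar₃ {I : Ideal R} {i : ℕ} (hf : Function.Injective f) (hg : Function.Surjective g)
    (he : Function.Exact f g) (hB : Ar I i B) (hA : Ar I (i+1) A) : Ar I i C :=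
  art_mid (exact₃ I (sc_exact hf hg he) i) hB hA

end ses

lemma V_of_forall {I : Ideal R} {i : ℕ} {M : Type u} [AddCommGroup M] [Module R M]
    (h : ∀ t, ∀ x : Abelian.Ext (Qm I t) (ModuleCat.of R M) i,
      ofT I i (ModuleCat.of R M) t x = 0) : V I i M := by
  refine subsingleton_of_forall_eq 0 fun y => ?_
  obtain ⟨t, x, rfl⟩ := ofT_surj y
  exact h t x

lemma V_of_injective (I : Ideal R) (i : ℕ) (M : Type u) [AddCommGroup M] [Module R M]
    [h : Module.Injective R M] : V I (i+1) M := by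
  have := (Module.injective_iff_injective_object R M).1 h
  refine V_of_forall fun t x => ?_
  rw [Abelian.Ext.eq_zero_of_injective x, map_zero]

lemma V_bot (i : ℕ) (M : Type u) [AddCommGroup M] [Module R M] : V (⊥ : Ideal R) (i+1) M := by
  refine V_of_forall fun t x => ?_
  rw [← ofT_tr (Nat.le_succ t)]
  have e : (R ⧸ (⊥ : Ideal R) ^ (t+1)) ≃ₗ[R] R :=
    Submodule.quotEquivOfEqBot _ (by rw [pow_succ]; simp)
  have : Module.Projective R (R ⧸ (⊥ : Ideal R) ^ (t+1)) := Module.Projective.of_equiv e.symm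
  have : Projective (Qm (⊥ : Ideal R) (t+1)) :=
    (IsProjective.iff_projective _).1 this
  rw [Abelian.Ext.eq_zero_of_projective (tr _ _ _ _ _ _ x), map_zero]

lemma V_of_bijective {I : Ideal R} (i : ℕ) (M : Type u) [AddCommGroup M] [Module R M] {x : R}
    (hx : x ∈ I) (hb : Function.Bijective (fun m : M => x • m)) : V I i M := by
  refine V_of_forall fun t y => ?_
  have hb' : Function.Bijective (LinearMap.lsmul R M (x ^ t)) := by
    have : ((LinearMap.lsmul R M (x ^ t) : M →ₗ[R] M) : M → M) = (fun m : M => x • m)^[t] := by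
      rw [smul_iterate]; rfl
    rw [this]
    exact hb.iterate t
  let e := LinearEquiv.ofBijective _ hb'
  let j : ModuleCat.of R M ⟶ ModuleCat.of R M := ModuleCat.ofHom e.symm.toLinearMap
  have hj : x ^ t • j = 𝟙 _ := by
    ext m
    exact e.apply_symm_apply m
  have h0 : x ^ t • 𝟙 (Qm I t) = 0 := by
    apply Qm_ext
    change x ^ t • (Ideal.Quotient.mk (I ^ t) 1) = 0
    rw [← Ideal.Quotient.mk_eq_mk, ← Submodule.Quotient.mk_smul]
    exact (Submodule.Quotient.mk_eq_zero _).2 (by simpa using Ideal.pow_mem_pow hx t)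
  have h1 : y = x ^ t • y.comp (Abelian.Ext.mk₀ j) (add_zero i) := by
    rw [← Abelian.Ext.comp_smul, ← Abelian.Ext.mk₀_smul, hj, Abelian.Ext.comp_mk₀_id]
  have h2 : ∀ z : Abelian.Ext (Qm I t) (ModuleCat.of R M) i, x ^ t • z = 0 := by
    intro z
    have : x ^ t • z = (Abelian.Ext.mk₀ (x ^ t • 𝟙 (Qm I t))).comp z (zero_add i) := by
      rw [Abelian.Ext.mk₀_smul, Abelian.Ext.smul_comp, Abelian.Ext.mk₀_id_comp]
    rw [this, h0, Abelian.Ext.mk₀_zero, Abelian.Ext.zero_comp]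
  rw [h1, h2, map_zero]

/-- `x`-power torsion. -/
def XT (x : R) (M : Type u) [AddCommGroup M] [Module R M] : Prop := ∀ m : M, ∃ k : ℕ, x ^ k • m = 0

/-- the submodule of `x`-power torsion elements -/
def Gam (x : R) (M : Type u) [AddCommGroup M] [Module R M] : Submodule R M where
  carrier := {m | ∃ k : ℕ, x ^ k • m = 0}
  zero_mem' := ⟨0, smul_zero _⟩
  add_mem' := by
    rintro a b ⟨k, hk⟩ ⟨l, hl⟩
    refine ⟨k + l, ?_⟩
    rw [smul_add, pow_add, mul_comm, mul_smul, hk, mul_comm, mul_smul, hl, smul_zero, smul_zero, add_zero]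
  smul_mem' := by
    rintro r a ⟨k, hk⟩
    exact ⟨k, by rw [smul_comm, hk, smul_zero]⟩

lemma XT_Gam (x : R) (M : Type u) [AddCommGroup M] [Module R M] : XT x (Gam x M) := by
  rintro ⟨m, k, hk⟩
  exact ⟨k, Subtype.ext hk⟩

lemma XT.quot {x : R} {M : Type u} [AddCommGroup M] [Module R M] (h : XT x M) (N : Submodule R M) :
    XT x (M ⧸ N) := by
  intro m
  obtain ⟨m, rfl⟩ := N.mkQ_surjective m
  obtain ⟨k, hk⟩ := h m
  exact ⟨k, by rw [← map_smul, hk, map_zero]⟩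

lemma XT.uniform {x : R} {M : Type u} [AddCommGroup M] [Module R M] (h : XT x M)
    {N : Type u} [AddCommGroup N] [Module R N] [hN : Module.Finite R N] (f : N →ₗ[R] M) :
    ∃ k : ℕ, ∀ n, x ^ k • f n = 0 := by
  obtain ⟨s, hs⟩ := hN.fg_top
  choose k hk using fun n => h (f n)
  refine ⟨s.sup k, fun n => ?_⟩
  have hn : n ∈ Submodule.span R (s : Set N) := hs ▸ Submodule.mem_top
  induction hn using Submodule.span_induction with
  | mem y hy =>
    obtain ⟨d, hd⟩ := Nat.exists_eq_add_of_le (Finset.le_sup (f := k) (Finset.mem_coe.1 hy))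
    rw [hd, add_comm, pow_add, mul_smul, hk, smul_zero]
  | zero => simp
  | add a b _ _ ha hb => rw [map_add, smul_add, ha, hb, add_zero]
  | smul r a _ ha => rw [map_smul, smul_comm, ha, smul_zero]

lemma Gam_injective [IsNoetherianRing R] (x : R) (E : Type u) [AddCommGroup E] [Module R E]
    (hE : Module.Injective R E) : Module.Injective R (Gam x E) := by
  apply Module.Baer.injective
  intro 𝔞 f
  obtain ⟨k, hk⟩ := (XT_Gam x E).uniform f
  let Q : ℕ →o Ideal R := ⟨fun n => Submodule.comap (LinearMap.lsmul R R (x ^ n)) 𝔞, by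
    intro a b hab r hr
    obtain ⟨d, rfl⟩ := Nat.exists_eq_add_of_le hab
    change x ^ (a + d) * r ∈ 𝔞
    rw [add_comm, pow_add, mul_assoc]
    exact 𝔞.mul_mem_left _ hr⟩
  obtain ⟨c, hc⟩ := (monotone_stabilizes_iff_noetherian (R := R) (M := R)).2 inferInstance Q
  let F : R →ₗ.[R] E := ⟨𝔞, (Gam x E).subtype ∘ₗ f⟩
  let G : R →ₗ.[R] E := ⟨Ideal.span {x ^ (k + c)}, 0⟩
  have hFG : ∀ (a : F.domain) (b : G.domain), (a : R) = b → F a = G b := by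
    rintro ⟨a, ha⟩ ⟨b, hb⟩ hab
    change a = b at hab
    subst hab
    obtain ⟨r, rfl⟩ := Ideal.mem_span_singleton'.1 hb
    have hr : r ∈ Q (k + c) := by
      change x ^ (k + c) * r ∈ 𝔞
      rw [mul_comm]; exact ha
    rw [← hc (k + c) (by omega)] at hr
    change x ^ c * r ∈ 𝔞 at hr
    have h3 := hk ⟨_, hr⟩
    rw [← map_smul] at h3
    have h4 : (⟨r * x ^ (k + c), ha⟩ : 𝔞) = x ^ k • ⟨x ^ c * r, hr⟩ := by
      apply Subtype.ext
      change r * x ^ (k + c) = x ^ k * (x ^ c * r)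
      ring
    change (f ⟨r * x ^ (k + c), ha⟩ : E) = 0
    rw [h4, h3]; rfl
  let H := F.sup G hFG
  obtain ⟨h, hh⟩ := Module.Baer.of_injective hE H.domain H.toFun
  have h1 : ∀ a (ha : a ∈ 𝔞), h a = f ⟨a, ha⟩ := by
    intro a ha
    rw [hh a (Submodule.mem_sup_left ha)]
    exact ((LinearPMap.left_le_sup F G hFG).2 (x := ⟨a, ha⟩) (y := ⟨a, Submodule.mem_sup_left ha⟩) rfl).symm
  have h2 : h (x ^ (k + c)) = 0 := by
    have hx : x ^ (k + c) ∈ G.domain := Ideal.mem_span_singleton_self _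
    rw [hh _ (Submodule.mem_sup_right hx)]
    exact ((LinearPMap.right_le_sup F G hFG).2 (x := ⟨_, hx⟩) (y := ⟨_, Submodule.mem_sup_right hx⟩) rfl).symm
  have h3 : h 1 ∈ Gam x E := ⟨k + c, by rw [← map_smul, smul_eq_mul, mul_one, h2]⟩
  refine ⟨LinearMap.toSpanSingleton R _ ⟨h 1, h3⟩, fun a ha => ?_⟩
  apply Subtype.ext
  rw [← h1 a ha]
  change a • h 1 = h a
  rw [← map_smul, smul_eq_mul, mul_one]

lemma exists_embed [IsNoetherianRing R] {x : R} {M : Type u} [AddCommGroup M] [Module R M]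
    (hM : XT x M) : ∃ (E : Type u) (_ : AddCommGroup E) (_ : Module R E) (f : M →ₗ[R] E),
      Function.Injective f ∧ XT x E ∧ Module.Injective R E := by
  let j := Injective.ι (ModuleCat.of R M)
  let E := Injective.under (ModuleCat.of R M)
  have hE : Module.Injective R E := (Module.injective_iff_injective_object R E).2
    (inferInstanceAs (Injective E))
  refine ⟨Gam x E, inferInstance, inferInstance, LinearMap.codRestrict _ j.hom ?_, ?_,
    XT_Gam x E, Gam_injective x E hE⟩
  · intro m
    obtain ⟨k, hk⟩ := hM m
    exact ⟨k, by rw [← map_smul, hk, map_zero]⟩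
  · rw [LinearMap.injective_codRestrict_iff]
    exact (ModuleCat.mono_iff_injective j).1 inferInstance

lemma ofT_eq {I : Ideal R} {i : ℕ} {M : ModuleCat.{u} R} {s t : ℕ} {x y}
    (h : ofT I i M s x = ofT I i M t y) :
    ∃ w, ∃ (h1 : s ≤ w) (h2 : t ≤ w), tr I i M s w h1 x = tr I i M t w h2 y := by
  have h1 : s ≤ s + t := Nat.le_add_right _ _
  have h2 : t ≤ s + t := Nat.le_add_left _ _
  rw [← ofT_tr h1 x, ← ofT_tr h2 y, ← sub_eq_zero, ← map_sub] at h
  obtain ⟨w, hw, h⟩ := ofT_zero h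
  rw [map_sub, sub_eq_zero] at h
  refine ⟨w, h1.trans hw, h2.trans hw, ?_⟩
  have e1 := DirectedSystem.map_map (f := fun s t h => tr I i M s t h) h1 hw x
  have e2 := DirectedSystem.map_map (f := fun s t h => tr I i M s t h) h2 hw y
  exact (e1.symm.trans h).trans e2

/-- the map from `R ⧸ I ^ t` attached to an element -/
noncomputable def el {I : Ideal R} {t : ℕ} {M : Type u} [AddCommGroup M] [Module R M] (m : M)
    (h : ∀ r ∈ I ^ t, r • m = 0) : Qm I t ⟶ ModuleCat.of R M :=
  ModuleCat.ofHom <| Submodule.liftQ _ (LinearMap.toSpanSingleton R M m) (fun r hr => h r hr)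

lemma el_one {I : Ideal R} {t : ℕ} {M : Type u} [AddCommGroup M] [Module R M] (m : M)
    (h : ∀ r ∈ I ^ t, r • m = 0) : (el m h).hom (Ideal.Quotient.mk _ 1) = m :=
  one_smul R m

lemma kill {I : Ideal R} {t : ℕ} {M : Type u} [AddCommGroup M] [Module R M]
    (f : Qm I t ⟶ ModuleCat.of R M) (r : R) (hr : r ∈ I ^ t) :
    r • (f.hom (Ideal.Quotient.mk _ 1) : M) = 0 := by
  have : r • (Ideal.Quotient.mk (I ^ t) 1) = 0 := by
    rw [← Ideal.Quotient.mk_eq_mk, ← Submodule.Quotient.mk_smul]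
    exact (Submodule.Quotient.mk_eq_zero _).2 (by simpa using hr)
  have h2 := congrArg f.hom this
  rw [map_zero] at h2
  exact (f.hom.map_smul r _).symm.trans h2

lemma tr_mk₀ {I : Ideal R} {M : ModuleCat.{u} R} {s t : ℕ} (h : s ≤ t) (f : Qm I s ⟶ M) :
    tr I 0 M s t h (Abelian.Ext.mk₀ f) = Abelian.Ext.mk₀ (qm I h ≫ f) :=
  Abelian.Ext.mk₀_comp_mk₀ _ _

lemma base {J : Ideal R} {x : R} {A B C : Type u} [AddCommGroup A] [AddCommGroup B]
    [AddCommGroup C] [Module R A] [Module R B] [Module R C] {f : A →ₗ[R] B} {g : B →ₗ[R] C}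
    (hf : Function.Injective f) (hg : Function.Surjective g) (he : Function.Exact f g)
    (hB : XT x B) (hJ : V J 1 A) (hI : V (J ⊔ Ideal.span {x}) 1 B) :
    V (J ⊔ Ideal.span {x}) 1 A := by
  set I := J ⊔ Ideal.span {x} with hIdef
  have S := sc_exact hf hg he
  have surj : Function.Surjective (mapT I (Abelian.Ext.mk₀ (sc f g he).g) (add_zero 0)) := by
    intro z
    obtain ⟨t, z, rfl⟩ := ofT_surj z
    obtain ⟨z, rfl⟩ : ∃ z', Abelian.Ext.mk₀ z' = z := ⟨_, Abelian.Ext.mk₀_homEquiv₀_apply z⟩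
    have hJI : J ^ t ≤ I ^ t := Ideal.pow_right_mono le_sup_left t
    let c : C := z.hom (Ideal.Quotient.mk _ 1)
    let z' : Qm J t ⟶ ModuleCat.of R C := el c fun r hr => kill z r (hJI hr)
    obtain ⟨y, hy⟩ := (exact₃ J S 0 (ofT J 0 _ t (Abelian.Ext.mk₀ z'))).1
      (@Subsingleton.elim _ hJ _ _)
    obtain ⟨s, y, rfl⟩ := ofT_surj y
    obtain ⟨y, rfl⟩ : ∃ y', Abelian.Ext.mk₀ y' = y := ⟨_, Abelian.Ext.mk₀_homEquiv₀_apply y⟩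
    rw [mapT_of, Abelian.Ext.mk₀_comp_mk₀] at hy
    obtain ⟨w, h1, h2, hw⟩ := ofT_eq hy
    rw [tr_mk₀, tr_mk₀] at hw
    have hw := (Abelian.Ext.mk₀_bijective _ _).1 hw
    have hw : g (y.hom (Ideal.Quotient.mk _ 1)) = c := by
      have := congrArg (fun φ => φ.hom (Ideal.Quotient.mk _ 1)) hw
      exact this.trans (el_one (I := J) (t := t) c fun r hr => kill z r (hJI hr))
    let b : B := y.hom (Ideal.Quotient.mk _ 1)
    obtain ⟨m, hm⟩ := hB b
    have hk : ∀ r ∈ I ^ (s + m + t), r • b = 0 := by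
      intro r hr
      have hr2 : r ∈ J ^ s ⊔ (Ideal.span {x}) ^ m :=
        Ideal.sup_pow_add_le_pow_sup_pow (Ideal.pow_le_pow_right (Nat.le_add_right _ _) hr)
      obtain ⟨p, hp, q, hq, rfl⟩ := Submodule.mem_sup.1 hr2
      rw [Ideal.span_singleton_pow] at hq
      obtain ⟨a, rfl⟩ := Ideal.mem_span_singleton'.1 hq
      rw [add_smul, mul_smul, hm, smul_zero, add_zero]
      exact kill y p hp
    refine ⟨ofT I 0 _ (s + m + t) (Abelian.Ext.mk₀ (el b hk)), ?_⟩
    rw [mapT_of, Abelian.Ext.mk₀_comp_mk₀, ← ofT_tr (Nat.le_add_left t (s + m)) (Abelian.Ext.mk₀ z),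
      tr_mk₀]
    congr 2
    apply Qm_ext
    exact (congrArg g (el_one b hk)).trans hw
  refine subsingleton_of_forall_eq 0 fun y => ?_
  obtain ⟨z, rfl⟩ := (exact₁ I S 0 y).1 (@Subsingleton.elim _ hI _ _)
  exact (exact₃ I S 0 z).2 (surj z)

lemma V_sup [IsNoetherianRing R] {J : Ideal R} {x : R} (i : ℕ) : ∀ (M : Type u) [AddCommGroup M]
    [Module R M], XT x M → V J (i + 1) M → V (J ⊔ Ideal.span {x}) (i + 1) M := by
  induction i with
  | zero =>
    intro M _ _ hM h
    obtain ⟨E, _, _, f, hf, hE, hE'⟩ := exists_embed hM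
    exact base hf (LinearMap.range f).mkQ_surjective (LinearMap.exact_map_mkQ_range f) hE h
      (V_of_injective _ _ _)
  | succ i ih =>
    intro M _ _ hM h
    obtain ⟨E, _, _, f, hf, hE, hE'⟩ := exists_embed hM
    have hs := (LinearMap.range f).mkQ_surjective
    have he := LinearMap.exact_map_mkQ_range f
    exact V₁ hf hs he (ih _ (hE.quot _) (V₃ hf hs he (V_of_injective _ _ _) h))
      (V_of_injective _ _ _)

lemma V_step [IsNoetherianRing R] {J : Ideal R} {x : R} {n : ℕ}
    (h : ∀ (M : Type u) [AddCommGroup M] [Module R M], ∀ i, n < i → V J i M)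
    (M : Type u) [AddCommGroup M] [Module R M] (i : ℕ) (hi : n + 1 < i) :
    V (J ⊔ Ideal.span {x}) i M := by
  obtain ⟨i, rfl⟩ : ∃ k, i = k + 2 := ⟨i - 2, by omega⟩
  set I := J ⊔ Ideal.span {x} with hIdef
  have hxI : x ∈ I := Ideal.mem_sup_right (Ideal.mem_span_singleton_self x)
  let S := Submonoid.powers x
  let L := LocalizedModule S M
  let ι : M →ₗ[R] L := LocalizedModule.mkLinearMap S M
  have hL : ∀ j, V I j L := by
    intro j
    refine V_of_bijective j L hxI ?_
    exact (Module.End.isUnit_iff _).1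
      (IsLocalizedModule.map_units ι (⟨x, Submonoid.mem_powers x⟩ : S))
  have hK : XT x (LinearMap.ker ι) := by
    rintro ⟨m, hm⟩
    obtain ⟨⟨c, k, rfl⟩, hc⟩ := (IsLocalizedModule.eq_zero_iff S ι).1 hm
    exact ⟨k, Subtype.ext hc⟩
  have hC : XT x (L ⧸ LinearMap.range ι) := by
    intro z
    obtain ⟨z, rfl⟩ := Submodule.mkQ_surjective _ z
    obtain ⟨⟨m, ⟨c, k, rfl⟩⟩, hc⟩ := IsLocalizedModule.surj S ι z
    refine ⟨k, ?_⟩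
    rw [← map_smul, Submodule.mkQ_apply, Submodule.Quotient.mk_eq_zero]
    exact ⟨m, hc.symm⟩
  have vK : V I (i + 2) (LinearMap.ker ι) := V_sup (i + 1) _ hK (h _ _ (by omega))
  have vC : V I (i + 1) (L ⧸ LinearMap.range ι) := V_sup i _ hC (h _ _ (by omega))
  have vR : V I (i + 2) (LinearMap.range ι) :=
    V₁ (Submodule.injective_subtype _) (Submodule.mkQ_surjective _)
      (LinearMap.exact_subtype_mkQ _) vC (hL _)
  refine V₂ (f := (LinearMap.ker ι).subtype) (g := ι.rangeRestrict)
    (Submodule.injective_subtype _) ι.surjective_rangeRestrict ?_ vK vR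
  rw [LinearMap.exact_iff]
  simp

theorem vanishing [IsNoetherianRing R] (I : Ideal R) : ∃ n : ℕ,
    ∀ (M : Type u) [AddCommGroup M] [Module R M], ∀ i, n < i → V I i M := by
  obtain ⟨s, rfl⟩ := (isNoetherianRing_iff_ideal_fg R).1 inferInstance I
  classical
  induction s using Finset.induction_on with
  | empty =>
    refine ⟨0, fun M _ _ i hi => ?_⟩
    obtain ⟨i, rfl⟩ := Nat.exists_eq_succ_of_ne_zero hi.ne'
    have h := V_bot (R := R) i M
    rw [← Ideal.span_empty] at h
    simpa using h
  | insert a s _ ih =>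
    obtain ⟨n, hn⟩ := ih
    refine ⟨n + 1, fun M _ _ i hi => ?_⟩
    have h := V_step (x := a) hn M i hi
    rw [Finset.coe_insert, Ideal.span_insert, sup_comm]
    exact h

open scoped TensorProduct in
lemma exists_map {N : Type u} [AddCommGroup N] [Module R N] [hN : Module.Finite R N]
    (p : PrimeSpectrum R) (hp : p ∈ Module.support R N) :
    ∃ θ : N →ₗ[R] (R ⧸ p.asIdeal), θ ≠ 0 := by
  let K := p.asIdeal.ResidueField
  have hnt : Nontrivial (K ⊗[R] N) :=
    (Module.mem_support_iff_nontrivial_residueField_tensorProduct p).1 hp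
  obtain ⟨v, hv⟩ := exists_ne (0 : K ⊗[R] N)
  obtain ⟨φ, hφ⟩ : ∃ φ : Module.Dual K (K ⊗[R] N), φ v ≠ 0 := by
    by_contra! hc
    exact hv ((Module.forall_dual_apply_eq_zero_iff K v).1 hc)
  let ψ : N →ₗ[R] K := (φ.restrictScalars R) ∘ₗ (TensorProduct.mk R K N 1)
  have hψ : ∃ n, ψ n ≠ 0 := by
    by_contra! hc
    apply hφ
    have : φ = 0 := by
      ext n
      exact hc n
    rw [this]; rfl
  obtain ⟨n₀, hn₀⟩ := hψ
  let A := R ⧸ p.asIdeal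
  let ι : A →ₗ[R] K := (Algebra.linearMap A K).restrictScalars R
  have hι : Function.Injective ι := IsFractionRing.injective A K
  obtain ⟨s, hs⟩ := hN.fg_top
  classical
  obtain ⟨b, hb⟩ := IsLocalization.exist_integer_multiples_of_finset (nonZeroDivisors A) (s.image ψ)
  obtain ⟨r, hr⟩ := Ideal.Quotient.mk_surjective (b : A)
  have hrb : ∀ z : K, r • z = (b : A) • z := by
    intro z
    rw [← hr]
    exact (algebraMap_smul A r z).symm
  have hmem : ∀ n, (r • ψ) n ∈ LinearMap.range ι := by
    intro n
    have hn : n ∈ Submodule.span R (s : Set N) := hs ▸ Submodule.mem_top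
    induction hn using Submodule.span_induction with
    | mem y hy =>
      obtain ⟨a, ha⟩ := hb (ψ y) (Finset.mem_image_of_mem _ hy)
      exact ⟨a, ha.trans (hrb _).symm⟩
    | zero => rw [map_zero]; exact zero_mem _
    | add a b _ _ ha hb => rw [map_add]; exact add_mem ha hb
    | smul c a _ ha => rw [map_smul]; exact Submodule.smul_mem _ _ ha
  let e := LinearEquiv.ofInjective ι hι
  refine ⟨e.symm.toLinearMap ∘ₗ LinearMap.codRestrict _ (r • ψ) hmem, fun h0 => hn₀ ?_⟩
  have h1 := LinearMap.congr_fun h0 n₀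
  have h2 : (⟨(r • ψ) n₀, hmem n₀⟩ : LinearMap.range ι) = 0 := (LinearEquiv.map_eq_zero_iff e.symm).1 h1
  have h3 : r • ψ n₀ = 0 := congrArg Subtype.val h2
  rw [hrb, Algebra.smul_def] at h3
  rcases mul_eq_zero.1 h3 with h | h
  · exact absurd (hι (h.trans (map_zero ι).symm)) (nonZeroDivisors.ne_zero b.2)
  · exact h

lemma V.ar {I : Ideal R} {i : ℕ} {M : Type u} [AddCommGroup M] [Module R M] (h : V I i M) :
    Ar I i M := by
  have : Subsingleton (T I i (ModuleCat.of R M)) := h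
  exact (inferInstance : IsArtinian R (T I i (ModuleCat.of R M)))

lemma V_subsingleton (I : Ideal R) (i : ℕ) (M : Type u) [AddCommGroup M] [Module R M]
    [Subsingleton M] : V I i M :=
  V_of_bijective i M I.zero_mem ⟨fun _ _ _ => Subsingleton.elim _ _, fun y => ⟨y, Subsingleton.elim _ _⟩⟩

lemma Ar_congr {I : Ideal R} {i : ℕ} {M N : Type u} [AddCommGroup M] [Module R M]
    [AddCommGroup N] [Module R N] (e : M ≃ₗ[R] N) (h : Ar I i M) : Ar I i N := by
  refine Ar₂ (f := (0 : PUnit.{u+1} →ₗ[R] N)) (g := e.symm.toLinearMap)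
    (fun _ _ _ => Subsingleton.elim _ _) e.symm.surjective ?_ (V_subsingleton _ _ _).ar h
  rw [LinearMap.exact_iff]
  simp

lemma devissage [IsNoetherianRing R] {I : Ideal R} {i : ℕ} {S : Set (PrimeSpectrum R)}
    (h : ∀ p ∈ S, Ar I i (R ⧸ p.asIdeal)) (M : Type u) [AddCommGroup M] [Module R M]
    [hM : Module.Finite R M] (hS : Module.support R M ⊆ S) : Ar I i M := by
  revert hS
  induction hM using IsNoetherianRing.induction_on_isQuotientEquivQuotientPrime R with
  | subsingleton N => exact fun _ => (V_subsingleton _ _ _).ar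
  | quotient N p e =>
    intro hS
    refine Ar_congr e.symm (h p (hS ?_))
    rw [e.support_eq, Module.support_eq_zeroLocus, Ideal.annihilator_quotient]
    exact (PrimeSpectrum.mem_zeroLocus _ _).2 le_rfl
  | exact N₁ N₂ N₃ f g hf hg he h₁ h₃ =>
    intro hS
    exact Ar₂ hf hg he (h₁ ((Module.support_subset_of_injective f hf).trans hS))
      (h₃ ((Module.support_subset_of_surjective g hg).trans hS))

lemma step [IsNoetherianRing R] {I : Ideal R} {i : ℕ} {N : Type u} [AddCommGroup N] [Module R N]
    [hN : Module.Finite R N] (hA : Ar I i N)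
    (h : ∀ (M : Type u) [AddCommGroup M] [Module R M] [Module.Finite R M],
      Module.support R M ⊆ Module.support R N → Ar I (i + 1) M)
    (M : Type u) [AddCommGroup M] [Module R M] [Module.Finite R M]
    (hM : Module.support R M ⊆ Module.support R N) : Ar I i M := by
  refine devissage (S := Module.support R N) (fun p => ?_) M hM
  have wf : WellFounded (fun a b : PrimeSpectrum R => b < a) :=
    InvImage.wf (fun p : PrimeSpectrum R => p.asIdeal)
      (wellFounded_gt : WellFounded ((· > ·) : Ideal R → Ideal R → Prop))
  induction p using wf.induction with
  | _ p ih =>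
  intro hp
  obtain ⟨θ, hθ⟩ := exists_map p hp
  have h1 : Ar I i (LinearMap.range θ) := by
    refine Ar₃ (f := (LinearMap.ker θ).subtype) (g := θ.rangeRestrict)
      (Submodule.injective_subtype _) θ.surjective_rangeRestrict ?_ hA (h _ ?_)
    · rw [LinearMap.exact_iff]; simp
    · exact Module.support_subset_of_injective _ (Submodule.injective_subtype _)
  have h2 : Ar I i ((R ⧸ p.asIdeal) ⧸ LinearMap.range θ) := by
    refine devissage (S := {q | p < q}) (fun q hq => ih q hq
      (Module.mem_support_mono (le_of_lt hq) hp)) _ ?_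
    intro q hq
    have hann := Module.annihilator_le_of_mem_support hq
    have hle : p.asIdeal ≤ q.asIdeal := by
      intro r hr
      apply hann
      rw [Module.mem_annihilator]
      intro z
      obtain ⟨z, rfl⟩ := Submodule.mkQ_surjective _ z
      obtain ⟨z, rfl⟩ := Submodule.mkQ_surjective _ z
      rw [← map_smul, ← map_smul]
      have : p.asIdeal.mkQ (r • z) = 0 :=
        (Submodule.Quotient.mk_eq_zero _).2 (Ideal.mul_mem_right _ _ hr)
      rw [this, map_zero]
    refine lt_of_le_not_ge hle fun hge => ?_
    obtain ⟨n, hn⟩ : ∃ n, θ n ≠ 0 := by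
      by_contra! hc
      exact hθ (LinearMap.ext hc)
    obtain ⟨r, hr⟩ := Submodule.mkQ_surjective _ (θ n)
    have hrp : r ∉ p.asIdeal := fun hrp => hn (hr ▸ (Submodule.Quotient.mk_eq_zero _).2 hrp)
    apply hrp
    apply hge
    apply hann
    rw [Module.mem_annihilator]
    intro z
    obtain ⟨z, rfl⟩ := Submodule.mkQ_surjective _ z
    obtain ⟨z, rfl⟩ := Submodule.mkQ_surjective _ z
    rw [← map_smul, Submodule.mkQ_apply, Submodule.Quotient.mk_eq_zero]
    refine ⟨z • n, ?_⟩
    rw [map_smul, ← hr, ← map_smul, ← map_smul, smul_eq_mul, smul_eq_mul, mul_comm]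
  exact Ar₂ (Submodule.injective_subtype _) (Submodule.mkQ_surjective _)
    (LinearMap.exact_subtype_mkQ _) h1 h2

theorem main [IsNoetherianRing R] {I : Ideal R} {i₀ : ℕ} {N : Type u} [AddCommGroup N] [Module R N]
    [hN : Module.Finite R N] (hA : ∀ i, i₀ ≤ i → Ar I i N)
    (M : Type u) [AddCommGroup M] [Module R M] [Module.Finite R M]
    (hM : Module.support R M ⊆ Module.support R N) : Ar I i₀ M := by
  obtain ⟨n, hn⟩ := vanishing I
  have key : ∀ k i, i₀ ≤ i → n < i + k → ∀ (M : Type u) [AddCommGroup M] [Module R M]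
      [Module.Finite R M], Module.support R M ⊆ Module.support R N → Ar I i M := by
    intro k
    induction k with
    | zero => exact fun i _ hi M _ _ _ _ => (hn M i hi).ar
    | succ k ih =>
      intro i hi hk
      exact fun M _ _ _ hM => step (hA i hi) (ih (i + 1) (by omega) (by omega)) M hM
  exact key (n + 1) i₀ le_rfl (by omega) M hM

lemma lc_artinian_iff (I : Ideal R) (i : ℕ) (M : ModuleCat.{u} R) :
    IsArtinian R ((localCohomology I i).obj M) ↔ Ar I i M := by
  obtain ⟨e⟩ := exists_lc_equiv I i M
  exact e.symm.isArtinian_iff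
end QD

theorem qDim_le_of_support_subset {R : Type u} [CommRing R] [IsNoetherianRing R]
    (I : Ideal R) (M N : ModuleCat.{u} R) (hM : Module.Finite R M) (hN : Module.Finite R N)
    (h : Module.support R M ⊆ Module.support R N) :
    qDim I M ≤ qDim I N := by
  refine sSup_le ?_
  rintro _ ⟨i, hi, rfl⟩
  by_contra hlt
  rw [not_le] at hlt
  refine hi ((QD.lc_artinian_iff I i M).2 (QD.main (N := N) (fun j hj => ?_) M h))
  refine (QD.lc_artinian_iff I j N).1 ?_
  by_contra hj'
  have h1 : ((j : ℕ∞) : WithBot ℕ∞) ≤ qDim I N := le_sSup ⟨j, hj', rfl⟩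
  have h2 : ((i : ℕ∞) : WithBot ℕ∞) ≤ ((j : ℕ∞) : WithBot ℕ∞) := by exact_mod_cast hj
  exact absurd (lt_of_le_of_lt (h2.trans h1) hlt) (lt_irrefl _)
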